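/- Let F be an ultrafilter on ℕ⁺ and suppose there exist a prime p and n ∈ ℕ with n ≥ 1 such that the set {m ∈ ℕ⁺ : pⁿ ∣ m and pⁿ⁺¹ ∤ m} belongs to F (i.e., pⁿ exactly divides F). Then F has an immediate predecessor in (βℕ⁺, ˜∣): there exists an ultrafilter G on ℕ⁺ with G ˜∣ F, not F ˜∣ G, and such that for every ultrafilter H with G ˜∣ H and H ˜∣ F, either H =∼ G or H =∼ F. -/

import Mathlib

/-- A set of positive integers is upward closed under divisibility. -/
def UpClosed (A : Set ℕ+) : Prop := ∀ a ∈ A, ∀ b : ℕ+, a ∣ b → b ∈ A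

/-- The divisibility relation `F ˜∣ G` on ultrafilters on `ℕ⁺`: every upward
closed set belonging to `F` also belongs to `G`. -/
def UDvd (F G : Ultrafilter ℕ+) : Prop :=
  ∀ A : Set ℕ+, UpClosed A → A ∈ F → A ∈ G

theorem PNat.mul_dvd_of_pow_dvd_of_not_pow_dvd {p : ℕ+} (hp : Nat.Prime (p : ℕ)) {n : ℕ}
    {x h : ℕ+} (hx : x ∣ h) (hh : p ^ n ∣ h) (hn : ¬ p ^ n ∣ x) : p * x ∣ h := by
  obtain ⟨k, rfl⟩ := hx
  rw [mul_comm p x]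
  refine mul_dvd_mul_left x ?_
  by_contra hk
  rw [PNat.dvd_iff] at hh hn hk
  simp only [PNat.mul_coe, PNat.pow_coe] at hh hn
  exact hn ((Nat.Coprime.pow_left n ((Nat.Prime.coprime_iff_not_dvd hp).2 hk)).dvd_of_dvd_mul_right
    hh)

theorem upClosed_setOf_exists_dvd (P : ℕ+ → Prop) : UpClosed {b | ∃ x, P x ∧ x ∣ b} :=
  fun _ ⟨x, hx, hxa⟩ _ hab => ⟨x, hx, hxa.trans hab⟩

theorem upClosed_setOf_dvd (a : ℕ+) : UpClosed {m | a ∣ m} :=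
  fun _ h _ hab => Dvd.dvd.trans h hab

/-- If some `pⁿ` with `p` prime and `n ≥ 1` exactly divides `F`, then `F` has
an immediate `˜∣`-predecessor. -/
theorem stmt19 (F : Ultrafilter ℕ+)
    (h : ∃ p : ℕ+, ∃ n : ℕ, Nat.Prime (p : ℕ) ∧ 1 ≤ n ∧
      {m : ℕ+ | p ^ n ∣ m ∧ ¬ p ^ (n + 1) ∣ m} ∈ F) :
    ∃ G : Ultrafilter ℕ+, UDvd G F ∧ ¬ UDvd F G ∧
      ∀ H : Ultrafilter ℕ+, UDvd G H → UDvd H F →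
        (UDvd H G ∧ UDvd G H) ∨ (UDvd H F ∧ UDvd F H) := by
  obtain ⟨p, n, hp, hn, hF⟩ := h
  -- The predecessor is the image of `F` under division by `p`.
  have hdiv : ∀ m : ℕ+, ∃ x : ℕ+, p ∣ m → m = p * x := fun m => by
    by_cases hm : p ∣ m
    · obtain ⟨x, hx⟩ := hm
      exact ⟨x, fun _ => hx⟩
    · exact ⟨1, fun h => absurd h hm⟩
  choose f hf using hdiv
  have hfm : ∀ m : ℕ+, p ^ n ∣ m → m = p * f m := fun m hm =>
    hf m ((dvd_pow_self p (by omega)).trans hm)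
  have hfn : ∀ m : ℕ+, p ^ n ∣ m → ¬ p ^ (n + 1) ∣ m → ¬ p ^ n ∣ f m := fun m hm hm' hd => by
    refine hm' ?_
    rw [hfm m hm, pow_succ']
    exact mul_dvd_mul_left p hd
  refine ⟨F.map f, fun A hA hAF => ?_, fun hFG => ?_, fun H hGH hHF => ?_⟩
  · rw [Ultrafilter.mem_map] at hAF
    filter_upwards [hAF, hF] with m hmA hm
    exact hA _ hmA _ ⟨p, by rw [mul_comm]; exact hfm m hm.1⟩
  · have hG := hFG _ (upClosed_setOf_dvd (p ^ n)) (Filter.mem_of_superset hF fun m hm => hm.1)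
    rw [Ultrafilter.mem_map] at hG
    obtain ⟨m, hm, hmF⟩ := Ultrafilter.nonempty_of_mem (Filter.inter_mem hG hF)
    exact hfn m hmF.1 hmF.2 hm
  · rcases H.mem_or_compl_mem {m | p ^ n ∣ m} with hH | hH
    · refine Or.inr ⟨hHF, fun A hA hAF => ?_⟩
      have hB := hGH _ (upClosed_setOf_exists_dvd fun x => ¬ p ^ n ∣ x ∧ p * x ∈ A) (by
        rw [Ultrafilter.mem_map]
        filter_upwards [hAF, hF] with m hmA hm
        exact ⟨f m, ⟨hfn m hm.1 hm.2, hfm m hm.1 ▸ hmA⟩, dvd_rfl⟩)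
      filter_upwards [hB, hH] with b hb hbn
      obtain ⟨x, ⟨hxn, hxA⟩, hxb⟩ := hb
      exact hA _ hxA _ (PNat.mul_dvd_of_pow_dvd_of_not_pow_dvd hp hxb hbn hxn)
    · refine Or.inl ⟨fun A hA hAH => ?_, hGH⟩
      have hB := hHF _ (upClosed_setOf_exists_dvd fun x => ¬ p ^ n ∣ x ∧ x ∈ A) (by
        filter_upwards [hAH, hH] with m hmA hm
        exact ⟨m, ⟨hm, hmA⟩, dvd_rfl⟩)
      rw [Ultrafilter.mem_map]
      filter_upwards [hB, hF] with m hm hmF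
      obtain ⟨x, ⟨hxn, hxA⟩, hxm⟩ := hm
      have hd := PNat.mul_dvd_of_pow_dvd_of_not_pow_dvd hp hxm hmF.1 hxn
      rw [hfm m hmF.1] at hd
      obtain ⟨c, hc⟩ := hd
      rw [mul_assoc] at hc
      exact hA _ hxA _ ⟨c, mul_left_cancel hc⟩
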